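/- Suppose F is ⪯ˡ_K-convex, locally l-bounded at x̄, and F(x̄) is strongly K-compact. Then the convex subdifferential of f_{l,x̄} at x̄ satisfies ∂f_{l,x̄}(x̄) = cl*conv( ⋃_{ȳ ∈ Min(F(x̄),K)} ⋃_{y* ∈ ∂Ψ_e(0)} D*E_F(x̄,ȳ)(y*) ), where cl*conv denotes the closure of the convex hull in the weak* topology of X*, E_F(x) := F(x) + K, and x* ∈ D*E_F(x̄,ȳ)(y*) means ⟨x*, x − x̄⟩ ≤ ⟨y*, y − ȳ⟩ for all (x,y) with y ∈ E_F(x). -/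

import Mathlib

open Set Topology Metric Pointwise

/-- The Gerstewitz (Tammer) scalarizing functional `Ψ_e(y) = inf {t : y ∈ t•e - K}`. -/
noncomputable def psiE {Y : Type*} [NormedAddCommGroup Y] [NormedSpace ℝ Y]
    (K : Set Y) (e : Y) (y : Y) : ℝ :=
  sInf {t : ℝ | t • e - y ∈ K}

/-- The lower inner function `g_l(x,z) = inf_{y ∈ F x} Ψ_e (y - z)` (with values in `EReal`). -/
noncomputable def glow {X Y : Type*} [NormedAddCommGroup X] [NormedSpace ℝ X]
    [NormedAddCommGroup Y] [NormedSpace ℝ Y]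
    (K : Set Y) (e : Y) (F : X → Set Y) (x : X) (z : Y) : EReal :=
  ⨅ y ∈ F x, (psiE K e (y - z) : EReal)

/-- The upper inner function `g_{u,x̄}(y) = inf_{ȳ ∈ F x̄} Ψ_e (y - ȳ)`. -/
noncomputable def gupp {X Y : Type*} [NormedAddCommGroup X] [NormedSpace ℝ X]
    [NormedAddCommGroup Y] [NormedSpace ℝ Y]
    (K : Set Y) (e : Y) (F : X → Set Y) (xbar : X) (y : Y) : EReal :=
  ⨅ yb ∈ F xbar, (psiE K e (y - yb) : EReal)

/-- The lower scalarizing functional `f_{l,x̄}(x) = sup_{ȳ ∈ F x̄} g_l(x, ȳ)`. -/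
noncomputable def flow {X Y : Type*} [NormedAddCommGroup X] [NormedSpace ℝ X]
    [NormedAddCommGroup Y] [NormedSpace ℝ Y]
    (K : Set Y) (e : Y) (F : X → Set Y) (xbar : X) (x : X) : EReal :=
  ⨆ yb ∈ F xbar, glow K e F x yb

/-- The upper scalarizing functional `f_{u,x̄}(x) = sup_{y ∈ F x} g_{u,x̄}(y)`. -/
noncomputable def fupp {X Y : Type*} [NormedAddCommGroup X] [NormedSpace ℝ X]
    [NormedAddCommGroup Y] [NormedSpace ℝ Y]
    (K : Set Y) (e : Y) (F : X → Set Y) (xbar : X) (x : X) : EReal :=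
  ⨆ y ∈ F x, gupp K e F xbar y

/-- Weakly minimal elements: `WMin(A,K) = {a ∈ A : (a - int K) ∩ A = ∅}`. -/
def wMinSet {Y : Type*} [NormedAddCommGroup Y] (A K : Set Y) : Set Y :=
  {a ∈ A | ∀ b ∈ A, a - b ∉ interior K}

/-- Weakly maximal elements: `WMax(A,K) = {a ∈ A : (a + int K) ∩ A = ∅}`. -/
def wMaxSet {Y : Type*} [NormedAddCommGroup Y] (A K : Set Y) : Set Y :=
  {a ∈ A | ∀ b ∈ A, b - a ∉ interior K}

/-- Minimal elements: `Min(A,K) = {a ∈ A : (a - K) ∩ A = {a}}`. -/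
def minSet {Y : Type*} [AddGroup Y] (A K : Set Y) : Set Y :=
  {a ∈ A | ∀ b ∈ A, a - b ∈ K → b = a}

theorem exists_weakDual_separating_eval {X : Type*} [NormedAddCommGroup X] [NormedSpace ℝ X]
    {S : Set (WeakDual ℝ X)} {xs : WeakDual ℝ X} (h : xs ∉ closure (convexHull ℝ S)) :
    ∃ (d : X) (r : ℝ), (∀ a ∈ S, a d < r) ∧ r < xs d := by
  have : LocallyConvexSpace ℝ (WeakDual ℝ X) :=
    inferInstanceAs (LocallyConvexSpace ℝ (WeakBilin (topDualPairing ℝ X)))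
  obtain ⟨f, r, hf, hr⟩ :=
    geometric_hahn_banach_closed_point (convex_convexHull ℝ S).closure isClosed_closure h
  obtain ⟨d, hd⟩ := LinearMap.dualEmbedding_surjective (topDualPairing ℝ X) f
  have hfd : ∀ a : WeakDual ℝ X, f a = a d := fun a => by rw [← hd]; rfl
  refine ⟨d, r, fun a ha => ?_, by rwa [← hfd]⟩
  rw [← hfd]
  exact hf a (subset_closure (subset_convexHull ℝ S ha))

/-- A simultaneous form of the max formula and the sandwich theorem for a convex graph `G` and a
sublinear functional `p`. -/
theorem exists_dual_pair_of_convex_graph {X Y : Type*} [NormedAddCommGroup X] [NormedSpace ℝ X]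
    [NormedAddCommGroup Y] [NormedSpace ℝ Y] {p : Y → ℝ} {L : ℝ}
    (hadd : ∀ y z, p (y + z) ≤ p y + p z) (hsmul : ∀ t : ℝ, 0 ≤ t → ∀ y, p (t • y) = t * p y)
    (hL : ∀ y, p y ≤ L * ‖y‖) {G : Set (X × Y)} (hG : Convex ℝ G) (hG0 : (0, 0) ∈ G)
    {d : X} {r : ℝ} (hray : ∀ s : ℝ, 0 ≤ s → ∀ w, (s • d, w) ∈ G → s * r ≤ p w)
    {C : ℝ} (hC : ∀ᶠ u in 𝓝 (0 : X), ∃ w, (u, w) ∈ G ∧ p w ≤ C) :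
    ∃ (xs : X →L[ℝ] ℝ) (ys : Y →L[ℝ] ℝ), (∀ y, ys y ≤ p y) ∧
      (∀ u w, (u, w) ∈ G → xs u ≤ ys w) ∧ r ≤ xs d := by
  have hp0 : p 0 = 0 := by simpa using hsmul 0 le_rfl 0
  let M : Set (X × Y × ℝ) := {q | ∃ s : ℝ, 0 ≤ s ∧ ∃ w : Y,
    (q.1 + s • d, q.2.1 + w) ∈ G ∧ p w - s * r < q.2.2}
  have hM : Convex ℝ M := by
    rintro ⟨a₁, b₁, c₁⟩ ⟨s₁, hs₁, w₁, hw₁, hc₁⟩ ⟨a₂, b₂, c₂⟩ ⟨s₂, hs₂, w₂, hw₂, hc₂⟩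
      t₁ t₂ ht₁ ht₂ ht
    refine ⟨t₁ * s₁ + t₂ * s₂, by positivity, t₁ • w₁ + t₂ • w₂, ?_, ?_⟩
    · convert hG hw₁ hw₂ ht₁ ht₂ ht using 1
      ext
      · simp; module
      · simp; module
    · have h := hadd (t₁ • w₁) (t₂ • w₂)
      rw [hsmul _ ht₁, hsmul _ ht₂] at h
      simp only [Prod.snd_add, Prod.smul_snd, smul_eq_mul] at hc₁ hc₂ ⊢
      rcases ht₁.eq_or_lt with rfl | ht₁'
      · obtain rfl : t₂ = 1 := by linarith
        linarith
      · nlinarith [mul_lt_mul_of_pos_left hc₁ ht₁', mul_le_mul_of_nonneg_left hc₂.le ht₂]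
  have hMint : (interior M).Nonempty := by
    refine ⟨(0, 0, C + |L| + 1), mem_interior_iff_mem_nhds.2 ?_⟩
    filter_upwards [prod_mem_nhds hC (prod_mem_nhds (ball_mem_nhds (0 : Y) one_pos)
      (Ioi_mem_nhds (show C + |L| < C + |L| + 1 by linarith)))]
    rintro ⟨a, b, c⟩ ⟨⟨w, hw, hwC⟩, hb, hc⟩
    refine ⟨0, le_rfl, w - b, by simpa using hw, ?_⟩
    have h := hadd w (-b)
    have h' := hL (-b)
    rw [norm_neg] at h'
    rw [← sub_eq_add_neg] at h
    simp only [mem_ball_zero_iff, mem_Ioi] at hb hc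
    have : L * ‖b‖ ≤ |L| := by nlinarith [le_abs_self L, norm_nonneg b, abs_nonneg L]
    simp only [zero_mul, sub_zero]
    linarith
  have hM0 : (0 : X × Y × ℝ) ∉ interior M := by
    intro h
    obtain ⟨s, hs, w, hw, hlt⟩ := interior_subset h
    have := hray s hs w (by simpa using hw)
    simp at hlt
    linarith
  obtain ⟨f, hf0, hf⟩ := geometric_hahn_banach_of_nonempty_interior_point hM hM0 hMint
  rw [map_zero] at hf
  let fx : X →L[ℝ] ℝ := f.comp (ContinuousLinearMap.inl ℝ X (Y × ℝ))
  let fy : Y →L[ℝ] ℝ :=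
    f.comp ((ContinuousLinearMap.inr ℝ X (Y × ℝ)).comp (ContinuousLinearMap.inl ℝ Y ℝ))
  let γ : ℝ := f (0, 0, 1)
  have hfs : ∀ a b c, f (a, b, c) = fx a + fy b + c * γ := by
    intro a b c
    have : ((a, b, c) : X × Y × ℝ) = (a, 0, 0) + (0, b, 0) + c • (0, 0, 1) := by simp
    rw [this, map_add, map_add, map_smul]
    rfl
  have key : ∀ u w, (u, w) ∈ G → ∀ s : ℝ, 0 ≤ s → ∀ w', ∀ ε > 0,
      fx u - s * fx d + (fy w - fy w') + (p w' - s * r + ε) * γ ≤ 0 := by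
    intro u w huw s hs w' ε hε
    have := hf (u - s • d, w - w', p w' - s * r + ε) ⟨s, hs, w', by simpa using huw, by simpa⟩
    rw [hfs] at this
    simpa using this
  have hγ : γ ≤ 0 := by simpa [hp0] using key 0 0 hG0 0 le_rfl 0 1 one_pos
  replace key : ∀ u w, (u, w) ∈ G → ∀ s : ℝ, 0 ≤ s → ∀ w',
      fx u - s * fx d + (fy w - fy w') + (p w' - s * r) * γ ≤ 0 := by
    intro u w huw s hs w'
    by_contra! hA
    set A := fx u - s * fx d + (fy w - fy w') + (p w' - s * r) * γ with hAdef
    have h := key u w huw s hs w' (A / (1 - γ)) (div_pos hA (by linarith))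
    have h1 : A + A / (1 - γ) * γ = A / (1 - γ) := by
      have : 1 - γ ≠ 0 := by linarith
      field_simp
      ring
    have h2 : 0 < A / (1 - γ) := div_pos hA (by linarith)
    nlinarith
  have hγ' : γ < 0 := by
    refine lt_of_le_of_ne hγ fun hγ0 => hf0 ?_
    have hfy : ∀ w, fy w = 0 := by
      intro w
      have h1 := key 0 0 hG0 0 le_rfl w
      have h2 := key 0 0 hG0 0 le_rfl (-w)
      simp only [hγ0, map_zero, map_neg] at h1 h2
      linarith
    have hfx : ∀ x, fx x ≤ 0 := by
      intro x
      have ht : Filter.Tendsto (fun t : ℝ => t • x) (𝓝[>] 0) (𝓝 0) := by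
        have : Continuous fun t : ℝ => t • x := by fun_prop
        simpa using (this.tendsto 0).mono_left nhdsWithin_le_nhds
      obtain ⟨t, ⟨w, hw, -⟩, ht0⟩ := ((ht.eventually hC).and self_mem_nhdsWithin).exists
      have h := key _ _ hw 0 le_rfl 0
      simp only [hγ0, hfy, map_smul, smul_eq_mul] at h
      have ht0 : 0 < t := ht0
      nlinarith
    ext q
    · have h1 := hfx q
      have h2 := hfx (-q)
      rw [map_neg] at h2
      exact le_antisymm h1 (neg_nonpos.1 h2)
    · exact hfy _
    · exact hγ0
  refine ⟨(-γ)⁻¹ • fx, -((-γ)⁻¹ • fy), fun y => ?_, fun u w huw => ?_, ?_⟩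
  · have h := key 0 0 hG0 0 le_rfl y
    simp only [map_zero] at h
    have : -(fy y) ≤ -γ * p y := by linarith
    simp only [neg_apply, smul_apply, smul_eq_mul,
      ← mul_neg]
    rwa [inv_mul_le_iff₀ (by linarith)]
  · have h := key u w huw 0 le_rfl 0
    simp only [map_zero, hp0] at h
    simp only [neg_apply, smul_apply, smul_eq_mul,
      ← mul_neg]
    exact mul_le_mul_of_nonneg_left (by linarith) (inv_nonneg.2 (by linarith))
  · have h := key 0 0 hG0 1 zero_le_one 0
    simp only [map_zero, hp0] at h
    simp only [smul_apply, smul_eq_mul]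
    rw [le_inv_mul_iff₀ (by linarith)]
    linarith

/-- `K` is a closed pointed convex cone with `e` in its interior. -/
structure IsSolidCone {Y : Type*} [NormedAddCommGroup Y] [NormedSpace ℝ Y]
    (K : Set Y) (e : Y) : Prop where
  isClosed : IsClosed K
  add_mem : ∀ {a b : Y}, a ∈ K → b ∈ K → a + b ∈ K
  smul_mem : ∀ {t : ℝ} {a : Y}, 0 ≤ t → a ∈ K → t • a ∈ K
  eq_zero_of_neg_mem : ∀ {a : Y}, a ∈ K → -a ∈ K → a = 0
  mem_interior : e ∈ interior K

namespace IsSolidCone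

variable {Y : Type*} [NormedAddCommGroup Y] [NormedSpace ℝ Y] {K : Set Y} {e : Y}

theorem mem (h : IsSolidCone K e) : e ∈ K := interior_subset h.mem_interior

theorem zero_mem (h : IsSolidCone K e) : (0 : Y) ∈ K := by
  simpa using h.smul_mem le_rfl h.mem

theorem eq_of_sub_mem (h : IsSolidCone K e) {a b : Y} (hab : a - b ∈ K) (hba : b - a ∈ K) :
    a = b :=
  sub_eq_zero.1 (h.eq_zero_of_neg_mem hab (by rwa [neg_sub]))

theorem sub_mem_trans (h : IsSolidCone K e) {a b c : Y} (hab : a - b ∈ K) (hbc : b - c ∈ K) :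
    a - c ∈ K := by
  simpa using h.add_mem hab hbc

theorem exists_smul_sub_mem (h : IsSolidCone K e) :
    ∃ L : ℝ, 0 ≤ L ∧ ∀ y, (L * ‖y‖) • e - y ∈ K := by
  obtain ⟨ε, hε, hball⟩ := Metric.mem_nhds_iff.1 (mem_interior_iff_mem_nhds.1 h.mem_interior)
  refine ⟨2 / ε, by positivity, fun y => ?_⟩
  rcases eq_or_ne y 0 with rfl | hy
  · simpa using h.zero_mem
  have hy' : 0 < ‖y‖ := norm_pos_iff.2 hy
  have ht : 0 < 2 / ε * ‖y‖ := by positivity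
  have hmem : e - (2 / ε * ‖y‖)⁻¹ • y ∈ K := by
    apply hball
    rw [mem_ball, dist_eq_norm, sub_sub_cancel_left, norm_neg, norm_smul, Real.norm_eq_abs,
      abs_of_pos (inv_pos.2 ht)]
    have : (2 / ε * ‖y‖)⁻¹ * ‖y‖ = ε / 2 := by field_simp
    linarith
  have := h.smul_mem ht.le hmem
  rwa [smul_sub, smul_smul, mul_inv_cancel₀ ht.ne', one_smul] at this

theorem smul_sub_mem_of_le (h : IsSolidCone K e) {s t : ℝ} (hst : s ≤ t) {y : Y}
    (hs : s • e - y ∈ K) : t • e - y ∈ K := by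
  have := h.add_mem hs (h.smul_mem (sub_nonneg.2 hst) h.mem)
  convert this using 1
  module

theorem nonneg_of_smul_mem (h : IsSolidCone K e) (he : e ≠ 0) {t : ℝ} (ht : t • e ∈ K) :
    0 ≤ t := by
  by_contra! hlt
  refine he (h.eq_zero_of_neg_mem h.mem ?_)
  have := h.smul_mem (inv_nonneg.2 (neg_nonneg.2 hlt.le)) ht
  rwa [smul_smul, inv_neg, neg_mul, inv_mul_cancel₀ hlt.ne, neg_one_smul] at this

theorem psiE_le_iff (h : IsSolidCone K e) (he : e ≠ 0) {y : Y} {t : ℝ} :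
    psiE K e y ≤ t ↔ t • e - y ∈ K := by
  obtain ⟨L, -, hL⟩ := h.exists_smul_sub_mem
  have hne : {t : ℝ | t • e - y ∈ K}.Nonempty := ⟨_, hL y⟩
  have hbdd : BddBelow {t : ℝ | t • e - y ∈ K} := by
    refine ⟨-(L * ‖-y‖), fun t ht => ?_⟩
    have := h.add_mem ht (hL (-y))
    have : (t + L * ‖-y‖) • e ∈ K := by
      convert this using 1
      module
    linarith [h.nonneg_of_smul_mem he this]
  have hcl : IsClosed {t : ℝ | t • e - y ∈ K} :=
    h.isClosed.preimage (f := fun t : ℝ => t • e - y) (by fun_prop)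
  exact ⟨fun ht => h.smul_sub_mem_of_le ht (hcl.csInf_mem hne hbdd), fun ht => csInf_le hbdd ht⟩

theorem psiE_smul_sub_mem (h : IsSolidCone K e) (he : e ≠ 0) (y : Y) :
    psiE K e y • e - y ∈ K :=
  (h.psiE_le_iff he).1 le_rfl

theorem eq_zero_of_unit_eq_zero (h : IsSolidCone K e) (he : e = 0) (y : Y) : y = 0 := by
  obtain ⟨L, -, hL⟩ := h.exists_smul_sub_mem
  have h₁ := hL y
  have h₂ := hL (-y)
  simp only [he, smul_zero, zero_sub, neg_neg] at h₁ h₂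
  exact h.eq_zero_of_neg_mem h₂ h₁

theorem psiE_zero (h : IsSolidCone K e) : psiE K e 0 = 0 := by
  rcases eq_or_ne e 0 with he | he
  · have : {t : ℝ | t • e - 0 ∈ K} = univ := eq_univ_of_forall fun t => by
      simpa [he] using h.zero_mem
    rw [psiE, this, Real.sInf_univ]
  · refine le_antisymm ((h.psiE_le_iff he).2 (by simpa using h.zero_mem)) ?_
    exact h.nonneg_of_smul_mem he (by simpa using h.psiE_smul_sub_mem he 0)

theorem psiE_le_of_mem (h : IsSolidCone K e) {y : Y} {t : ℝ} (ht : 0 ≤ t) (hy : t • e - y ∈ K) :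
    psiE K e y ≤ t := by
  rcases eq_or_ne e 0 with he | he
  · rwa [h.eq_zero_of_unit_eq_zero he y, h.psiE_zero]
  · exact (h.psiE_le_iff he).2 hy

theorem psiE_mono (h : IsSolidCone K e) {y z : Y} (hyz : z - y ∈ K) :
    psiE K e y ≤ psiE K e z := by
  rcases eq_or_ne e 0 with he | he
  · rw [h.eq_zero_of_unit_eq_zero he y, h.eq_zero_of_unit_eq_zero he z]
  · exact (h.psiE_le_iff he).2 (h.sub_mem_trans (h.psiE_smul_sub_mem he z) hyz)

theorem psiE_add_le (h : IsSolidCone K e) (y z : Y) :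
    psiE K e (y + z) ≤ psiE K e y + psiE K e z := by
  rcases eq_or_ne e 0 with he | he
  · simp [h.eq_zero_of_unit_eq_zero he y, h.eq_zero_of_unit_eq_zero he z, h.psiE_zero]
  · rw [h.psiE_le_iff he]
    convert h.add_mem (h.psiE_smul_sub_mem he y) (h.psiE_smul_sub_mem he z) using 1
    module

theorem psiE_smul (h : IsSolidCone K e) {t : ℝ} (ht : 0 ≤ t) (y : Y) :
    psiE K e (t • y) = t * psiE K e y := by
  rcases eq_or_ne e 0 with he | he
  · simp [h.eq_zero_of_unit_eq_zero he y, h.psiE_zero]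
  have hle : ∀ {s : ℝ}, 0 ≤ s → ∀ z, psiE K e (s • z) ≤ s * psiE K e z := fun hs z => by
    rw [h.psiE_le_iff he, mul_smul, ← smul_sub]
    exact h.smul_mem hs (h.psiE_smul_sub_mem he z)
  rcases ht.eq_or_lt with rfl | ht'
  · simp [h.psiE_zero]
  refine le_antisymm (hle ht y) ?_
  have := hle (inv_nonneg.2 ht) (t • y)
  rw [inv_smul_smul₀ ht'.ne'] at this
  rwa [le_inv_mul_iff₀ ht'] at this

theorem neg_mem_of_psiE_neg (h : IsSolidCone K e) {y : Y} (hy : psiE K e y < 0) : -y ∈ K := by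
  rcases eq_or_ne e 0 with he | he
  · simp [h.eq_zero_of_unit_eq_zero he y, h.psiE_zero] at hy
  · simpa using (h.psiE_le_iff he (t := 0)).1 hy.le

theorem exists_psiE_le_mul_norm (h : IsSolidCone K e) :
    ∃ L : ℝ, ∀ y, psiE K e y ≤ L * ‖y‖ := by
  obtain ⟨L, hL0, hL⟩ := h.exists_smul_sub_mem
  exact ⟨L, fun y => h.psiE_le_of_mem (by positivity) (hL y)⟩

theorem continuous_psiE (h : IsSolidCone K e) : Continuous (psiE K e) := by
  obtain ⟨L, hL⟩ := h.exists_psiE_le_mul_norm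
  refine (LipschitzWith.of_le_add_mul' L fun y z => ?_).continuous
  have := h.psiE_add_le z (y - z)
  rw [add_sub_cancel] at this
  rw [dist_eq_norm]
  linarith [hL (y - z)]

theorem psiE_sub_nonneg_of_mem_minSet (h : IsSolidCone K e) {A : Set Y} {m : Y}
    (hm : m ∈ minSet A K) {y : Y} (hy : y ∈ A) : 0 ≤ psiE K e (y - m) := by
  by_contra! hlt
  have hym := hm.2 y hy (by simpa using h.neg_mem_of_psiE_neg hlt)
  rw [hym, sub_self, h.psiE_zero] at hlt
  exact lt_irrefl _ hlt

/-- Domination property: in a strongly `K`-compact set every element lies above a minimal one. -/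
theorem exists_mem_minSet_sub_mem (h : IsSolidCone K e) {A B : Set Y} (hBA : B ⊆ A)
    (hB : IsCompact B) (hBK : B + K = A + K) {b : Y} (hb : b ∈ B) :
    ∃ m ∈ minSet A K, b - m ∈ K := by
  let S : Type _ := {c : Y // c ∈ B ∧ b - c ∈ K}
  let r : S → S → Prop := fun c d => c.1 - d.1 ∈ K
  have : Nonempty S := ⟨⟨b, hb, by simpa using h.zero_mem⟩⟩
  have htrans : ∀ {x y z : S}, r x y → r y z → r x z := fun hxy hyz => h.sub_mem_trans hxy hyz
  obtain ⟨⟨m, hmB, hbm⟩, hm⟩ : ∃ m : S, ∀ a, r m a → r a m := by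
    refine exists_maximal_of_nonempty_chains_bounded (fun c hc hcne => ?_) htrans
    have : Nonempty c := hcne.to_subtype
    have hcont : ∀ a : Y, IsClosed {z : Y | a - z ∈ K} := fun a =>
      h.isClosed.preimage (f := fun z : Y => a - z) (by fun_prop)
    have hrefl : ∀ a : S, r a a := fun a => by
      change a.1 - a.1 ∈ K
      simpa using h.zero_mem
    have hdir : Directed (· ⊇ ·) fun a : c => B ∩ {z : Y | a.1.1 - z ∈ K} := by
      intro x y
      have hxyr : r x.1 y.1 ∨ r y.1 x.1 := by
        rcases eq_or_ne x.1 y.1 with hxy | hxy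
        · exact Or.inl (hxy ▸ hrefl _)
        · exact hc x.2 y.2 hxy
      rcases hxyr with hxy | hxy
      · exact ⟨y, fun z hz => ⟨hz.1, h.sub_mem_trans hxy hz.2⟩, Subset.rfl⟩
      · exact ⟨x, Subset.rfl, fun z hz => ⟨hz.1, h.sub_mem_trans hxy hz.2⟩⟩
    obtain ⟨z, hz⟩ := IsCompact.nonempty_iInter_of_directed_nonempty_isCompact_isClosed _ hdir
      (fun a => ⟨a.1.1, a.1.2.1, hrefl a.1⟩)
      (fun a => hB.inter_right (hcont _)) (fun a => hB.isClosed.inter (hcont _))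
    rw [mem_iInter] at hz
    let a₀ : c := Classical.arbitrary c
    exact ⟨⟨z, (hz a₀).1, h.sub_mem_trans a₀.1.2.2 (hz a₀).2⟩, fun a ha => (hz ⟨a, ha⟩).2⟩
  refine ⟨m, ⟨hBA hmB, fun y hy hmy => ?_⟩, hbm⟩
  obtain ⟨z, hz, k, hk, rfl⟩ : y ∈ B + K := by
    rw [hBK]
    exact ⟨y, hy, 0, h.zero_mem, add_zero y⟩
  have hmz : m - z ∈ K := h.sub_mem_trans hmy (by simpa using hk)
  have hzm : z - m ∈ K := hm ⟨z, hz, h.sub_mem_trans hbm hmz⟩ hmz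
  obtain rfl := h.eq_of_sub_mem hmz hzm
  exact h.eq_of_sub_mem (by simpa using hk) hmy

end IsSolidCone

/-- Local `l`-boundedness yields a uniform upper bound for the scalarized values near `xbar`. -/
theorem eventually_exists_psiE_le {X Y : Type*} [NormedAddCommGroup X] [NormedAddCommGroup Y]
    [NormedSpace ℝ Y] {K : Set Y} {e : Y} {F : X → Set Y} {xbar : X}
    (h : IsSolidCone K e) (hdom : xbar ∈ interior {x | (F x).Nonempty}) {μ : ℝ} (hμ : 0 ≤ μ)
    {U : Set X} (hU : U ∈ 𝓝 xbar)
    (hbd : ∀ x ∈ U, (F x ∩ {y : Y | y + μ • e ∈ K ∧ μ • e - y ∈ K}) + K = F x + K) (m : Y) :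
    ∀ᶠ u in 𝓝 (0 : X), ∃ w, w + m ∈ F (xbar + u) + K ∧ psiE K e w ≤ μ + psiE K e (-m) := by
  have ht : Filter.Tendsto (fun u : X => xbar + u) (𝓝 0) (𝓝 xbar) := by
    simpa using (continuous_const_add xbar).tendsto 0
  filter_upwards [ht hU, ht (mem_interior_iff_mem_nhds.1 hdom)] with u hu hne
  obtain ⟨y, hy⟩ := hne
  obtain ⟨z, ⟨hz, -, hzμ⟩, -⟩ : y ∈ (F (xbar + u) ∩ _) + K := by
    rw [hbd _ hu]
    exact ⟨y, hy, 0, h.zero_mem, add_zero _⟩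
  refine ⟨z - m, ⟨z, hz, 0, h.zero_mem, by simp⟩, ?_⟩
  rw [sub_eq_add_neg]
  linarith [h.psiE_add_le z (-m), h.psiE_le_of_mem hμ hzμ]

section SetValued

variable {X Y : Type*} [NormedAddCommGroup X] [NormedSpace ℝ X] [NormedAddCommGroup Y]
  [NormedSpace ℝ Y] {K : Set Y} {e : Y} {F : X → Set Y} {xbar : X}

theorem flow_self_eq_zero (h : IsSolidCone K e) {m : Y} (hm : m ∈ minSet (F xbar) K) :
    flow K e F xbar xbar = 0 := by
  refine le_antisymm (iSup₂_le fun y hy => iInf₂_le_of_le y hy ?_)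
    (le_iSup₂_of_le m hm.1 (le_iInf₂ fun y hy => ?_))
  · simp [h.psiE_zero]
  · exact EReal.coe_nonneg.2 (h.psiE_sub_nonneg_of_mem_minSet hm hy)

theorem convex_epigraph (h : IsSolidCone K e)
    (hconv : ∀ x₁ x₂ : X, (F x₁).Nonempty → (F x₂).Nonempty → ∀ t : ℝ, t ∈ Set.Ioo (0:ℝ) 1 →
      t • F x₁ + (1 - t) • F x₂ ⊆ F (t • x₁ + (1 - t) • x₂) + K) (m : Y) :
    Convex ℝ {q : X × Y | q.2 + m ∈ F (xbar + q.1) + K} := by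
  rw [convex_iff_forall_pos]
  rintro ⟨u₁, w₁⟩ ⟨z₁, hz₁, k₁, hk₁, e₁⟩ ⟨u₂, w₂⟩ ⟨z₂, hz₂, k₂, hk₂, e₂⟩ a b ha hb hab
  obtain rfl : b = 1 - a := by linarith
  obtain ⟨z, hz, k, hk, hzk⟩ := hconv _ _ ⟨z₁, hz₁⟩ ⟨z₂, hz₂⟩ a ⟨ha, by linarith⟩
    (add_mem_add (smul_mem_smul_set hz₁) (smul_mem_smul_set hz₂))
  refine ⟨z, ?_, k + (a • k₁ + (1 - a) • k₂),
    h.add_mem hk (h.add_mem (h.smul_mem ha.le hk₁) (h.smul_mem hb.le hk₂)), ?_⟩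
  · convert hz using 2
    simp only [Prod.fst_add, Prod.smul_fst]
    module
  · simp only [Prod.snd_add, Prod.smul_snd] at e₁ e₂ hzk ⊢
    obtain rfl : w₁ = z₁ + k₁ - m := eq_sub_of_add_eq e₁.symm
    obtain rfl : w₂ = z₂ + k₂ - m := eq_sub_of_add_eq e₂.symm
    rw [← add_assoc, hzk]
    module

/-- Convexity along a ray: a base point good for a short step is good for a longer one. -/
theorem mul_le_psiE_of_le (h : IsSolidCone K e)
    (hconv : ∀ x₁ x₂ : X, (F x₁).Nonempty → (F x₂).Nonempty → ∀ t : ℝ, t ∈ Set.Ioo (0:ℝ) 1 →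
      t • F x₁ + (1 - t) • F x₂ ⊆ F (t • x₁ + (1 - t) • x₂) + K)
    {b : Y} (hb : b ∈ F xbar) {d : X} {r s t : ℝ} (ht : 0 < t) (hts : t ≤ s)
    (hbt : ∀ y ∈ F (xbar + t • d), t * r ≤ psiE K e (y - b)) {y : Y}
    (hy : y ∈ F (xbar + s • d)) : s * r ≤ psiE K e (y - b) := by
  rcases hts.eq_or_lt with rfl | hlt
  · exact hbt y hy
  have hs : 0 < s := ht.trans hlt
  have hl : 0 < t / s := div_pos ht hs
  obtain ⟨z, hz, k, hk, hzk⟩ := hconv _ _ ⟨y, hy⟩ ⟨b, hb⟩ (t / s) ⟨hl, (div_lt_one hs).2 hlt⟩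
    (add_mem_add (smul_mem_smul_set hy) (smul_mem_smul_set hb))
  have hpt : (t / s) • (xbar + s • d) + (1 - t / s) • xbar = xbar + t • d := by
    rw [smul_add, smul_smul, div_mul_cancel₀ _ hs.ne']
    module
  rw [hpt] at hz
  have h₁ := hbt z hz
  have h₂ : psiE K e (z - b) ≤ psiE K e ((t / s) • (y - b)) := by
    apply h.psiE_mono
    convert hk using 1
    simp only at hzk
    obtain rfl : k = (t / s) • y + (1 - t / s) • b - z := eq_sub_of_add_eq' hzk
    module
  rw [h.psiE_smul hl.le] at h₂
  have h₃ := h₁.trans h₂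
  rw [div_mul_eq_mul_div, le_div_iff₀ hs] at h₃
  exact le_of_mul_le_mul_left (by linarith) ht

theorem exists_mem_forall_mul_le_psiE (h : IsSolidCone K e)
    (hconv : ∀ x₁ x₂ : X, (F x₁).Nonempty → (F x₂).Nonempty → ∀ t : ℝ, t ∈ Set.Ioo (0:ℝ) 1 →
      t • F x₁ + (1 - t) • F x₂ ⊆ F (t • x₁ + (1 - t) • x₂) + K)
    {B : Set Y} (hBF : B ⊆ F xbar) (hB : IsCompact B) {d : X} {r : ℝ}
    (hlow : ∀ s : ℝ, 0 < s → ∃ b ∈ B, ∀ y ∈ F (xbar + s • d), s * r ≤ psiE K e (y - b)) :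
    ∃ b ∈ B, ∀ s : ℝ, 0 < s → ∀ y ∈ F (xbar + s • d), s * r ≤ psiE K e (y - b) := by
  let C : Ioi (0 : ℝ) → Set Y := fun s =>
    {b | b ∈ B ∧ ∀ y ∈ F (xbar + s.1 • d), s.1 * r ≤ psiE K e (y - b)}
  have hCcl : ∀ s, IsClosed (C s) := by
    intro s
    have hy : ∀ y, IsClosed {b | s.1 * r ≤ psiE K e (y - b)} := fun y =>
      isClosed_le continuous_const
        (h.continuous_psiE.comp (continuous_const.sub continuous_id))
    convert hB.isClosed.inter
      (isClosed_biInter (s := F (xbar + s.1 • d)) fun y _ => hy y) using 1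
    ext b
    simp [C]
  have hCmono : ∀ s t : Ioi (0 : ℝ), t ≤ s → C t ⊆ C s := fun s t hts b hb =>
    ⟨hb.1, fun y hy => mul_le_psiE_of_le h hconv (hBF hb.1) t.2 hts hb.2 hy⟩
  have : Nonempty (Ioi (0 : ℝ)) := ⟨⟨1, mem_Ioi.2 one_pos⟩⟩
  obtain ⟨b, hb⟩ := IsCompact.nonempty_iInter_of_directed_nonempty_isCompact_isClosed C
    (fun s t => ⟨min s t, hCmono _ _ (min_le_left s t), hCmono _ _ (min_le_right s t)⟩)
    (fun s => hlow s s.2) (fun s => hB.of_isClosed_subset (hCcl s) fun b hb => hb.1) hCcl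
  rw [mem_iInter] at hb
  exact ⟨b, (hb ⟨1, mem_Ioi.2 one_pos⟩).1, fun s hs => (hb ⟨s, hs⟩).2⟩

theorem exists_forall_mul_le_psiE_of_lt_flow (h : IsSolidCone K e) {B : Set Y}
    (hBK : B + K = F xbar + K) {x : X} {c : ℝ} (hc : (c : EReal) < flow K e F xbar x) :
    ∃ b ∈ B, ∀ y ∈ F x, c ≤ psiE K e (y - b) := by
  obtain ⟨y₀, hlt⟩ := lt_iSup_iff.1 hc
  obtain ⟨hy₀, hlt⟩ := lt_iSup_iff.1 hlt
  obtain ⟨b, hb, k, hk, rfl⟩ : y₀ ∈ B + K := by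
    rw [hBK]
    exact ⟨y₀, hy₀, 0, h.zero_mem, add_zero _⟩
  refine ⟨b, hb, fun y hy => ?_⟩
  have h₁ : c ≤ psiE K e (y - (b + k)) :=
    EReal.coe_le_coe_iff.1 (hlt.le.trans (iInf₂_le y hy))
  exact h₁.trans (h.psiE_mono (by simpa using hk))

end SetValued

/-- for F ⪯ˡ_K-convex, locally l-bounded at x̄, with F(x̄) strongly K-compact,
the convex subdifferential of f_{l,x̄} at x̄ equals the weak*-closed convex hull of the union,
over ȳ ∈ Min(F(x̄),K) and y* ∈ ∂Ψ_e(0), of the coderivatives D*E_F(x̄,ȳ)(y*). The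
subdifferential is taken inside `WeakDual ℝ X`, whose topology is the weak* topology. -/
theorem stmt15
    {X Y : Type*} [NormedAddCommGroup X] [NormedSpace ℝ X] [CompleteSpace X]
    [NormedAddCommGroup Y] [NormedSpace ℝ Y] [CompleteSpace Y]
    (K : Set Y) (e : Y) (F : X → Set Y) (Ω : Set X) (xbar : X)
    (hKcl : IsClosed K) (hKcv : Convex ℝ K)
    (hKcone : ∀ t : ℝ, 0 ≤ t → ∀ y ∈ K, t • y ∈ K)
    (hKpt : K ∩ (-K) = {0})
    (he : e ∈ interior K)
    (hΩne : Ω.Nonempty) (hΩcl : IsClosed Ω)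
    (hΩdom : Ω ⊆ interior {x | (F x).Nonempty})
    (hxΩ : xbar ∈ Ω)
    (hconv : ∀ x₁ x₂ : X, (F x₁).Nonempty → (F x₂).Nonempty → ∀ t : ℝ, t ∈ Set.Ioo (0:ℝ) 1 →
      t • F x₁ + (1 - t) • F x₂ ⊆ F (t • x₁ + (1 - t) • x₂) + K)
    (hbd : ∃ μ > (0:ℝ), ∃ U ∈ 𝓝 xbar, ∀ x ∈ U,
      (F x ∩ {y : Y | y + μ • e ∈ K ∧ μ • e - y ∈ K}) + K = F x + K)
    (hcmp : ∃ B : Set Y, B ⊆ F xbar ∧ IsCompact B ∧ B + K = F xbar + K) :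
    {xs : WeakDual ℝ X | ∀ x : X,
        flow K e F xbar xbar + ((xs (x - xbar) : ℝ) : EReal) ≤ flow K e F xbar x} =
      closure (convexHull ℝ
        {xs : WeakDual ℝ X | ∃ ybar ∈ minSet (F xbar) K, ∃ ys : Y →L[ℝ] ℝ,
          (∀ y : Y, ys y ≤ psiE K e y) ∧
          ∀ x : X, ∀ y ∈ F x + K, xs (x - xbar) ≤ ys (y - ybar)}) := by
  have h : IsSolidCone K e :=
    { isClosed := hKcl
      smul_mem := fun ht ha => hKcone _ ht _ ha
      add_mem := fun {a b} ha hb => by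
        have := hKcone 2 zero_le_two _
          (hKcv ha hb one_half_pos.le one_half_pos.le (add_halves (1 : ℝ)))
        rwa [← smul_add, smul_smul, mul_one_div_cancel two_ne_zero, one_smul] at this
      eq_zero_of_neg_mem := fun ha hna => by
        have := hKpt.subset ⟨ha, hna⟩
        simpa using this
      mem_interior := he }
  obtain ⟨B, hBF, hB, hBK⟩ := hcmp
  have hne : xbar ∈ {x | (F x).Nonempty} := interior_subset (hΩdom hxΩ)
  obtain ⟨y₀, hy₀⟩ := hne
  obtain ⟨b₀, hb₀, -⟩ : y₀ ∈ B + K := by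
    rw [hBK]
    exact ⟨y₀, hy₀, 0, h.zero_mem, add_zero _⟩
  obtain ⟨m₀, hm₀, -⟩ := h.exists_mem_minSet_sub_mem hBF hB hBK hb₀
  simp only [flow_self_eq_zero h hm₀, zero_add]
  apply Subset.antisymm
  · intro xs hxs
    by_contra hxs'
    obtain ⟨d, r, hSr, hr⟩ := exists_weakDual_separating_eval hxs'
    obtain ⟨b, hb, hbr⟩ := exists_mem_forall_mul_le_psiE h hconv hBF hB (d := d) (r := r)
      fun s hs => by
        refine exists_forall_mul_le_psiE_of_lt_flow h hBK (lt_of_lt_of_le ?_ (hxs (xbar + s • d)))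
        rw [add_sub_cancel_left, map_smul, smul_eq_mul, EReal.coe_lt_coe_iff]
        exact mul_lt_mul_of_pos_left hr hs
    obtain ⟨m, hm, hbm⟩ := h.exists_mem_minSet_sub_mem hBF hB hBK hb
    obtain ⟨μ, hμ, U, hU, hUbd⟩ := hbd
    obtain ⟨L, hL⟩ := h.exists_psiE_le_mul_norm
    obtain ⟨xs', ys, hys, hgraph, hd⟩ := exists_dual_pair_of_convex_graph h.psiE_add_le
      (fun t ht y => h.psiE_smul ht y) hL (convex_epigraph (xbar := xbar) h hconv m)
      (d := d) (r := r) ⟨m, by simpa using hm.1, 0, h.zero_mem, by simp⟩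
      (fun s hs w hw => by
        obtain ⟨z, hz, k, hk, hzk⟩ := hw
        have hzw : psiE K e (z - m) ≤ psiE K e w := by
          apply h.psiE_mono
          convert hk using 1
          simp only at hzk
          rw [sub_sub_eq_add_sub, ← hzk, add_sub_cancel_left]
        refine le_trans ?_ hzw
        rcases hs.eq_or_lt with rfl | hs
        · rw [zero_mul]
          exact h.psiE_sub_nonneg_of_mem_minSet hm (by simpa using hz)
        · exact (hbr s hs z hz).trans (h.psiE_mono (by simpa using hbm)))
      (eventually_exists_psiE_le h (hΩdom hxΩ) hμ.le hU hUbd m)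
    refine (hSr (StrongDual.toWeakDual xs') ⟨m, hm, ys, hys, fun x y hy => ?_⟩).not_ge hd
    exact hgraph (x - xbar) (y - m) (by simpa using hy)
  · refine closure_minimal (convexHull_min ?_ ?_) ?_
    · rintro xs ⟨m, hm, ys, hys, hgraph⟩ x
      refine le_iSup₂_of_le m hm.1 (le_iInf₂ fun y hy => EReal.coe_le_coe_iff.2 ?_)
      exact (hgraph x y ⟨y, hy, 0, h.zero_mem, add_zero _⟩).trans (hys _)
    · simp only [ofPred_forall]
      refine convex_iInter fun x => ?_
      have hlin : IsLinearMap ℝ fun xs : WeakDual ℝ X => xs (x - xbar) :=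
        ⟨fun _ _ => rfl, fun _ _ => rfl⟩
      have hord : OrdConnected {c : ℝ | (c : EReal) ≤ flow K e F xbar x} :=
        ⟨fun _ _ _ hb _ hc => (EReal.coe_le_coe_iff.2 hc.2).trans hb⟩
      exact hord.convex.is_linear_preimage hlin
    · simp only [ofPred_forall]
      refine isClosed_iInter fun x => isClosed_le ?_ continuous_const
      exact continuous_coe_real_ereal.comp (WeakDual.eval_continuous (x - xbar))
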